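/- (Representation Theorem for Orthomodular Lattices.) The image T = {ρ(x) | x ∈ L} ⊆ Set 𝒮 is closed under binary intersection, binary union, and the operation ~, and contains ρ(⊥) and ρ(⊤); moreover ρ is a bijection from L onto T that preserves the full structure: ρ(x ⊓ y) = ρ(x) ∩ ρ(y), ρ(x ⊔ y) = ρ(x) ∪ ρ(y), ρ(xᗮ) = ~(ρ(x)), and x ≤ y ↔ ρ(x) ⊆ ρ(y). Hence T, ordered by inclusion, is a sublattice of sets of the powerset lattice of 𝒮 isomorphic to L via the lattice-embedding ρ. -/

import Mathlib

def dia {𝒮 : Type*} (R : 𝒮 → 𝒮 → Prop) (S : Set 𝒮) : Set 𝒮 :=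
  {s : 𝒮 | ∃ s', R s s' ∧ s' ∈ S}

def box {𝒮 : Type*} (R : 𝒮 → 𝒮 → Prop) (S : Set 𝒮) : Set 𝒮 :=
  {s : 𝒮 | ∀ s', R s s' → s' ∈ S}

def qneg {𝒮 : Type*} (R : 𝒮 → 𝒮 → Prop) (S : Set 𝒮) : Set 𝒮 := dia R Sᶜ

theorem dia_union {𝒮 : Type*} (R : 𝒮 → 𝒮 → Prop) (A B : Set 𝒮) :
    dia R (A ∪ B) = dia R A ∪ dia R B := by
  ext s
  simp only [dia, Set.mem_ofPred_eq, Set.mem_union, and_or_left, exists_or]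

theorem qneg_inter {𝒮 : Type*} (R : 𝒮 → 𝒮 → Prop) (A B : Set 𝒮) :
    qneg R (A ∩ B) = qneg R A ∪ qneg R B := by
  simp only [qneg, Set.compl_inter, dia_union]

theorem representation_theorem {𝒮 : Type*} (R : 𝒮 → 𝒮 → Prop)
    {L : Type*} [Lattice L] [BoundedOrder L]
    (oc : L → L)
    (hinv : ∀ x, oc (oc x) = x)
    (hdisj : ∀ x, x ⊓ oc x = ⊥)
    (hexh : ∀ x, x ⊔ oc x = ⊤)
    (hanti : ∀ x y : L, x ≤ y → oc y ≤ oc x)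
    (hdm : ∀ x y : L, x ⊔ y = oc (oc x ⊓ oc y))
    (hom : ∀ x y : L, x ≤ y → y = x ⊔ (y ⊓ oc x))
    (ρ : L → Set 𝒮)
    (hinj : Function.Injective ρ)
    (hcomp : ∀ x, ρ (oc x) = qneg R (ρ x))
    (hmeet : ∀ x y, ρ (x ⊓ y) = ρ x ∩ ρ y) :
    (∀ x y : L, ρ x ∩ ρ y ∈ Set.range ρ) ∧
    (∀ x y : L, ρ x ∪ ρ y ∈ Set.range ρ) ∧
    (∀ x : L, qneg R (ρ x) ∈ Set.range ρ) ∧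
    ρ (⊥ : L) ∈ Set.range ρ ∧
    ρ (⊤ : L) ∈ Set.range ρ ∧
    Set.BijOn ρ Set.univ (Set.range ρ) ∧
    (∀ x y : L, ρ (x ⊓ y) = ρ x ∩ ρ y) ∧
    (∀ x y : L, ρ (x ⊔ y) = ρ x ∪ ρ y) ∧
    (∀ x : L, ρ (oc x) = qneg R (ρ x)) ∧
    (∀ x y : L, x ≤ y ↔ ρ x ⊆ ρ y) := by
  have hjoin (x y : L) : ρ (x ⊔ y) = ρ x ∪ ρ y := by
    rw [hdm, hcomp, hmeet, qneg_inter, ← hcomp, ← hcomp, hinv, hinv]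
  have hle (x y : L) : x ≤ y ↔ ρ x ⊆ ρ y := by
    rw [← inf_eq_left, ← hinj.eq_iff, hmeet, Set.inter_eq_left]
  refine ⟨fun x y ↦ ⟨x ⊓ y, hmeet x y⟩, fun x y ↦ ⟨x ⊔ y, hjoin x y⟩,
    fun x ↦ ⟨oc x, hcomp x⟩, ⟨⊥, rfl⟩, ⟨⊤, rfl⟩, ?_, hmeet, hjoin, hcomp, hle⟩
  rw [← Set.image_univ]
  exact hinj.injOn.bijOn_image
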